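/- Let X_1,...,X_d (d ≥ 2) and Y be discrete random variables with values in finite sets, jointly distributed with strictly positive pmf P. Let P_NB(x,y) = P_Y(y)·∏_{i=1}^d P(x_i|y) be the Naive Bayes approximation, and let P_GNB be the chain Generalized Naive Bayes approximation P_GNB(x,y) = ( ∏_{i=1}^{d−1} P(y, x_i, x_{i+1}) ) / ( ∏_{i=2}^{d−1} P(y, x_i) ). Then KL(P ‖ P_GNB) ≤ KL(P ‖ P_NB), i.e. the Generalized Naive Bayes approximation fits P at least as well as the Naive Bayes approximation. -/

import Mathlib

open scoped Classical BigOperators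
open Real

noncomputable section

namespace GNB

variable {d : ℕ} {α : Fin d → Type} {β : Type} [∀ i, Fintype (α i)] [Fintype β]

/-- A joint configuration of the explanatory variables `X i` and the class variable `Y`. -/
abbrev Cfg (α : Fin d → Type) (β : Type) := ((i : Fin d) → α i) × β

/-- Marginal pmf of the class variable `Y`. -/
def margY (P : Cfg α β → ℝ) (y : β) : ℝ := ∑ x : (i : Fin d) → α i, P (x, y)

/-- Marginal pmf of the variable `X i`. -/
def margX (P : Cfg α β → ℝ) (i : Fin d) (a : α i) : ℝ :=
  ∑ z : Cfg α β, if z.1 i = a then P z else 0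

/-- Marginal pmf of the pair `(X i, Y)`. -/
def margXY (P : Cfg α β → ℝ) (i : Fin d) (a : α i) (y : β) : ℝ :=
  ∑ x : (i : Fin d) → α i, if x i = a then P (x, y) else 0

/-- Marginal pmf of the triplet `(X i, X j, Y)`. -/
def margXXY (P : Cfg α β → ℝ) (i j : Fin d) (a : α i) (b : α j) (y : β) : ℝ :=
  ∑ x : (i : Fin d) → α i, if x i = a ∧ x j = b then P (x, y) else 0

/-- Joint entropy `H(X_1,…,X_d,Y)`. -/
def HJoint (P : Cfg α β → ℝ) : ℝ := -∑ z : Cfg α β, P z * Real.log (P z)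

/-- Entropy `H(Y)`. -/
def HY (P : Cfg α β → ℝ) : ℝ := -∑ y : β, margY P y * Real.log (margY P y)

/-- Entropy `H(X i)`. -/
def HX (P : Cfg α β → ℝ) (i : Fin d) : ℝ :=
  -∑ a : α i, margX P i a * Real.log (margX P i a)

/-- Entropy `H(Y, X i)`. -/
def HYX (P : Cfg α β → ℝ) (i : Fin d) : ℝ :=
  -∑ y : β, ∑ a : α i, margXY P i a y * Real.log (margXY P i a y)

/-- Entropy `H(Y, X i, X j)`. -/
def HYXX (P : Cfg α β → ℝ) (i j : Fin d) : ℝ :=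
  -∑ y : β, ∑ a : α i, ∑ b : α j, margXXY P i j a b y * Real.log (margXXY P i j a b y)

/-- Mutual information `I(X i ; Y)`. -/
def IY2 (P : Cfg α β → ℝ) (i : Fin d) : ℝ :=
  ∑ y : β, ∑ a : α i, margXY P i a y *
    Real.log (margXY P i a y / (margX P i a * margY P y))

/-- Information content `I(Y, X i, X j)`. -/
def IY3 (P : Cfg α β → ℝ) (i j : Fin d) : ℝ :=
  ∑ y : β, ∑ a : α i, ∑ b : α j, margXXY P i j a b y *
    Real.log (margXXY P i j a b y / (margY P y * margX P i a * margX P j b))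

/-- Kullback–Leibler divergence `KL(p ‖ q)`. -/
def KL {γ : Type} [Fintype γ] (p q : γ → ℝ) : ℝ := ∑ c : γ, p c * Real.log (p c / q c)

/-- The Naive Bayes approximation `P_NB(x,y) = P(y) ∏ i, P(x i | y)`. -/
def PNB (P : Cfg α β → ℝ) : Cfg α β → ℝ :=
  fun z => margY P z.2 * ∏ i : Fin d, (margXY P i (z.1 i) z.2 / margY P z.2)

/-- The Generalized Naive Bayes approximation determined by the mother function `μ`:
`P_GNB(x,y) = (∏_{i=2}^d P(y, x_{μ i}, x_i)) / (∏_{i=3}^d P(y, x_{μ i}))`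
(indices are `0`-based: variable `X_k` of the paper is `X (k-1)` here). -/
def PGNB (P : Cfg α β → ℝ) (μ : Fin d → Fin d) : Cfg α β → ℝ :=
  fun z =>
    (∏ i ∈ Finset.univ.filter (fun i : Fin d => 1 ≤ (i : ℕ)),
        margXXY P (μ i) i (z.1 (μ i)) (z.1 i) z.2) /
    (∏ i ∈ Finset.univ.filter (fun i : Fin d => 2 ≤ (i : ℕ)),
        margXY P (μ i) (z.1 (μ i)) z.2)

/-- Predecessor on `Fin d` (truncated at `0`). -/
def pred (i : Fin d) : Fin d := ⟨(i : ℕ) - 1, lt_of_le_of_lt (Nat.sub_le _ _) i.isLt⟩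

end GNB

namespace GNB

variable {d : ℕ} {α : Fin d → Type} {β : Type} [∀ i, Fintype (α i)]

theorem margY_pos {P : Cfg α β → ℝ} (hpos : ∀ z, 0 < P z) (z : Cfg α β) :
    0 < margY P z.2 :=
  Finset.sum_pos (fun _ _ => hpos _) ⟨z.1, Finset.mem_univ _⟩

theorem margXY_nonneg {P : Cfg α β → ℝ} (hpos : ∀ z, 0 < P z) (i : Fin d) (a : α i) (y : β) :
    0 ≤ margXY P i a y :=
  Finset.sum_nonneg fun x _ => by split_ifs <;> simp [(hpos _).le]

theorem margXY_pos {P : Cfg α β → ℝ} (hpos : ∀ z, 0 < P z) (i : Fin d) (z : Cfg α β) :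
    0 < margXY P i (z.1 i) z.2 :=
  Finset.sum_pos' (fun x _ => by split_ifs <;> simp [(hpos _).le])
    ⟨z.1, Finset.mem_univ _, by simp [hpos]⟩

theorem margXXY_pos {P : Cfg α β → ℝ} (hpos : ∀ z, 0 < P z) (i j : Fin d) (z : Cfg α β) :
    0 < margXXY P i j (z.1 i) (z.1 j) z.2 :=
  Finset.sum_pos' (fun x _ => by split_ifs <;> simp [(hpos _).le])
    ⟨z.1, Finset.mem_univ _, by simp [hpos]⟩

theorem sum_margXY (P : Cfg α β → ℝ) (i : Fin d) (y : β) :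
    ∑ a, margXY P i a y = margY P y := by
  simp only [margXY, margY]
  rw [Finset.sum_comm]
  simp

/-- The expectation of a function of `(X i, X j)` on the slice `Y = y` only depends on the
marginal of the triplet. -/
theorem sum_mul_eq_sum_margXXY_mul (P : Cfg α β → ℝ) (i j : Fin d) (y : β)
    (f : α i → α j → ℝ) :
    ∑ x : (k : Fin d) → α k, P (x, y) * f (x i) (x j) =
      ∑ a, ∑ b, margXXY P i j a b y * f a b := by
  simp only [margXXY, Finset.sum_mul]
  simp_rw [Finset.sum_comm (s := (Finset.univ : Finset (α j))),
    Finset.sum_comm (s := (Finset.univ : Finset (α i)))]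
  refine Finset.sum_congr rfl fun x _ => ?_
  simp [ite_and, ite_mul]

theorem sum_slice_ratio_le_margY {P : Cfg α β → ℝ} (hpos : ∀ z, 0 < P z) (i j : Fin d) (y : β) :
    ∑ x : (k : Fin d) → α k, P (x, y) * (margXY P i (x i) y * margXY P j (x j) y /
      (margXXY P i j (x i) (x j) y * margY P y)) ≤ margY P y := by
  rw [sum_mul_eq_sum_margXXY_mul P i j y
    (fun a b => margXY P i a y * margXY P j b y / (margXXY P i j a b y * margY P y))]
  have hY : 0 ≤ margY P y := Finset.sum_nonneg fun _ _ => (hpos _).le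
  calc _ ≤ ∑ a, ∑ b, margXY P i a y * margXY P j b y / margY P y := by
        refine Finset.sum_le_sum fun a _ => Finset.sum_le_sum fun b _ => ?_
        have hc : 0 ≤ margXY P i a y * margXY P j b y / margY P y :=
          div_nonneg (mul_nonneg (margXY_nonneg hpos i a y) (margXY_nonneg hpos j b y)) hY
        by_cases h : margXXY P i j a b y = 0
        · simpa [h] using hc
        · refine le_of_eq ?_
          rw [mul_div_assoc', mul_div_mul_left _ _ h]
    _ = margY P y := by
        simp_rw [← Finset.sum_div, ← Finset.mul_sum, ← Finset.sum_mul, sum_margXY]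
        exact mul_self_div_self _

/-- The conditional mutual information `I(X i ; X j | Y)` is nonnegative. -/
theorem condMutualInfo_nonneg [Fintype β] {P : Cfg α β → ℝ} (hpos : ∀ z, 0 < P z)
    (i j : Fin d) :
    0 ≤ ∑ z : Cfg α β, P z * (Real.log (margXXY P i j (z.1 i) (z.1 j) z.2)
      - Real.log (margXY P i (z.1 i) z.2)
      - (Real.log (margXY P j (z.1 j) z.2) - Real.log (margY P z.2))) := by
  have hle : ∑ z : Cfg α β, P z * (margXY P i (z.1 i) z.2 * margXY P j (z.1 j) z.2 /
      (margXXY P i j (z.1 i) (z.1 j) z.2 * margY P z.2)) ≤ ∑ z, P z := by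
    rw [Fintype.sum_prod_type_right, Fintype.sum_prod_type_right]
    exact Finset.sum_le_sum fun y _ => sum_slice_ratio_le_margY hpos i j y
  refine le_trans (sub_nonneg.2 hle) ?_
  rw [← Finset.sum_sub_distrib]
  refine Finset.sum_le_sum fun z _ => ?_
  have h₁ := margXY_pos hpos i z
  have h₂ := margXY_pos hpos j z
  have h₃ := margXXY_pos hpos i j z
  have h₄ := margY_pos hpos z
  have hlog := Real.log_le_sub_one_of_pos (div_pos (mul_pos h₁ h₂) (mul_pos h₃ h₄))
  rw [Real.log_div (mul_pos h₁ h₂).ne' (mul_pos h₃ h₄).ne', Real.log_mul h₁.ne' h₂.ne',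
    Real.log_mul h₃.ne' h₄.ne'] at hlog
  rw [← mul_one_sub]
  exact mul_le_mul_of_nonneg_left (by linarith) (hpos z).le

theorem PNB_pos [Fintype β] {P : Cfg α β → ℝ} (hpos : ∀ z, 0 < P z) (z : Cfg α β) :
    0 < PNB P z :=
  mul_pos (margY_pos hpos z)
    (Finset.prod_pos fun i _ => div_pos (margXY_pos hpos i z) (margY_pos hpos z))

theorem PGNB_pos [Fintype β] {P : Cfg α β → ℝ} (hpos : ∀ z, 0 < P z) (μ : Fin d → Fin d)
    (z : Cfg α β) : 0 < PGNB P μ z :=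
  div_pos (Finset.prod_pos fun i _ => margXXY_pos hpos (μ i) i z)
    (Finset.prod_pos fun i _ => margXY_pos hpos (μ i) z)

theorem sum_eq_add_sum_filter_one_le (n : ℕ) (f : Fin (n + 2) → ℝ) :
    ∑ i, f i = f 0 + ∑ i ∈ Finset.univ.filter (fun i : Fin (n + 2) => 1 ≤ (i : ℕ)), f i := by
  rw [Finset.sum_filter, Fin.sum_univ_succ, Fin.sum_univ_succ (n := n + 1)]
  simp

theorem sum_filter_one_le_eq_add_sum_filter_two_le (n : ℕ) (f : Fin (n + 2) → ℝ) :
    ∑ i ∈ Finset.univ.filter (fun i : Fin (n + 2) => 1 ≤ (i : ℕ)), f i =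
      f 1 + ∑ i ∈ Finset.univ.filter (fun i : Fin (n + 2) => 2 ≤ (i : ℕ)), f i := by
  rw [Finset.sum_filter, Finset.sum_filter]
  simp [Fin.sum_univ_succ]

/-- The log-ratio of the chain approximation and the Naive Bayes approximation is a sum of
pointwise conditional mutual informations along the chain. -/
theorem log_PGNB_pred_sub_log_PNB [Fintype β] (hd : 2 ≤ d) {P : Cfg α β → ℝ}
    (hpos : ∀ z, 0 < P z) (z : Cfg α β) :
    Real.log (PGNB P (fun i => pred i) z) - Real.log (PNB P z) =
      ∑ i ∈ Finset.univ.filter (fun i : Fin d => 1 ≤ (i : ℕ)),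
        (Real.log (margXXY P (pred i) i (z.1 (pred i)) (z.1 i) z.2)
          - Real.log (margXY P (pred i) (z.1 (pred i)) z.2)
          - (Real.log (margXY P i (z.1 i) z.2) - Real.log (margY P z.2))) := by
  obtain ⟨n, rfl⟩ := Nat.exists_eq_add_of_le' hd
  have hY := margY_pos hpos z
  have hX := fun i => margXY_pos hpos i z
  rw [PGNB, PNB,
    Real.log_div (Finset.prod_pos fun i _ => margXXY_pos hpos (pred i) i z).ne'
      (Finset.prod_pos fun i _ => hX (pred i)).ne',
    Real.log_mul hY.ne' (Finset.prod_pos fun i _ => div_pos (hX i) hY).ne',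
    Real.log_prod fun i _ => (margXXY_pos hpos (pred i) i z).ne',
    Real.log_prod fun i _ => (hX (pred i)).ne',
    Real.log_prod fun i _ => (div_pos (hX i) hY).ne']
  simp_rw [fun i => Real.log_div (hX i).ne' hY.ne']
  simp only [Finset.sum_sub_distrib]
  rw [sum_eq_add_sum_filter_one_le n (fun i => Real.log (margXY P i (z.1 i) z.2)),
    sum_eq_add_sum_filter_one_le n (fun _ => Real.log (margY P z.2)),
    sum_filter_one_le_eq_add_sum_filter_two_le n
      (fun i => Real.log (margXY P (pred i) (z.1 (pred i)) z.2))]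
  have h1 : pred (1 : Fin (n + 2)) = 0 := rfl
  rw [h1]
  ring

end GNB

/-- The chain Generalized Naive Bayes approximation fits `P` at least as
well as the Naive Bayes approximation: `KL(P ‖ P_GNB) ≤ KL(P ‖ P_NB)`.
The chain structure is the GNB structure whose mother function is `pred`
(`0`-based indices), i.e. `P_GNB(x,y) = (∏_{i=1}^{d−1} P(y,xᵢ,xᵢ₊₁)) / (∏_{i=2}^{d−1} P(y,xᵢ))`. -/
theorem kl_gnb_le_kl_nb (d : ℕ) (hd : 2 ≤ d) (α : Fin d → Type) (β : Type)
    [∀ i, Fintype (α i)] [∀ i, Nonempty (α i)] [Fintype β] [Nonempty β]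
    (P : GNB.Cfg α β → ℝ) (hpos : ∀ z, 0 < P z) (hsum : ∑ z, P z = 1) :
    GNB.KL P (GNB.PGNB P (fun i => GNB.pred i)) ≤ GNB.KL P (GNB.PNB P) := by
  rw [← sub_nonneg, GNB.KL, GNB.KL, ← Finset.sum_sub_distrib]
  have key : ∀ z, P z * Real.log (P z / GNB.PNB P z)
      - P z * Real.log (P z / GNB.PGNB P (fun i => GNB.pred i) z) =
      P z * (Real.log (GNB.PGNB P (fun i => GNB.pred i) z) - Real.log (GNB.PNB P z)) := by
    intro z
    rw [Real.log_div (hpos z).ne' (GNB.PNB_pos hpos z).ne',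
      Real.log_div (hpos z).ne' (GNB.PGNB_pos hpos _ z).ne']
    ring
  simp_rw [key, GNB.log_PGNB_pred_sub_log_PNB hd hpos, Finset.mul_sum]
  rw [Finset.sum_comm]
  exact Finset.sum_nonneg fun i _ => GNB.condMutualInfo_nonneg hpos (GNB.pred i) i
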